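/- Let G be a strongly connected weighted digraph on N nodes with Laplacian L and normalized positive left eigenvector r for eigenvalue zero. Let W : [0,∞) → ℝ^{N×N} be the solution of the matrix differential equation Ẇ(t) = −L W(t) with W(0) = I_N (equivalently, the stacked vector dynamics ż = −(L ⊗ I_N)z with z_i(0) = e_i). Then for every i and every t ≥ 0 the diagonal entry W_{ii}(t) is strictly positive, and it converges exponentially to r_i: there exist c, λ > 0 such that |W_{ii}(t) − r_i| ≤ c e^{−λ t} for all t ≥ 0 and all i. -/

import Mathlib

open Matrix Finset

/-- The Laplacian matrix of a weighted digraph with adjacency weights `a`. -/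
def graphLaplacian {N : ℕ} (a : Fin N → Fin N → ℝ) : Matrix (Fin N) (Fin N) ℝ :=
  Matrix.of fun i j => if i = j then ∑ k, a i k else -(a i j)

/-- Strong connectivity: every ordered pair of distinct nodes is joined by a
directed path along edges (`(j,i)` is an edge iff `a i j > 0`). -/
def StronglyConnected {N : ℕ} (a : Fin N → Fin N → ℝ) : Prop :=
  ∀ i j : Fin N, i ≠ j → Relation.TransGen (fun u v : Fin N => 0 < a v u) i j

/-- The Laplacian disagreement `∑ᵢⱼ rᵢ aᵢⱼ (xᵢ - xⱼ)²` weighted by `r`. -/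
def disagreement {N : ℕ} (a : Fin N → Fin N → ℝ) (r x : Fin N → ℝ) : ℝ :=
  ∑ i, ∑ j, r i * a i j * (x i - x j) ^ 2

section Laplacian

variable {N : ℕ} {a : Fin N → Fin N → ℝ} {r : Fin N → ℝ}

lemma graphLaplacian_apply (ha_diag : ∀ i, a i i = 0) (i j : Fin N) :
    graphLaplacian a i j = (if i = j then ∑ k, a i k else 0) - a i j := by
  by_cases h : i = j
  · subst h; simp [graphLaplacian, ha_diag]
  · simp [graphLaplacian, h]

lemma graphLaplacian_mulVec (ha_diag : ∀ i, a i i = 0) (x : Fin N → ℝ) (i : Fin N) :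
    (graphLaplacian a *ᵥ x) i = ∑ k, a i k * (x i - x k) := by
  simp [Matrix.mulVec, dotProduct, graphLaplacian_apply ha_diag, sub_mul, mul_sub,
    Finset.sum_sub_distrib, Finset.sum_mul]

lemma sum_weight_eq_of_vecMul_eq_zero (ha_diag : ∀ i, a i i = 0)
    (hr_left : Matrix.vecMul r (graphLaplacian a) = 0) (j : Fin N) :
    ∑ i, r i * a i j = r j * ∑ k, a j k := by
  have h := congrFun hr_left j
  simp [Matrix.vecMul, dotProduct, graphLaplacian_apply ha_diag, mul_sub,
    Finset.sum_sub_distrib] at h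
  linarith

lemma disagreement_eq (ha_diag : ∀ i, a i i = 0)
    (hr_left : Matrix.vecMul r (graphLaplacian a) = 0) (x : Fin N → ℝ) :
    disagreement a r x = 2 * ∑ i, r i * x i * (graphLaplacian a *ᵥ x) i := by
  have key : ∑ i, ∑ j, r i * a i j * x j ^ 2 = ∑ i, ∑ j, r i * a i j * x i ^ 2 := by
    rw [Finset.sum_comm]
    refine Finset.sum_congr rfl fun j _ => ?_
    rw [← Finset.sum_mul, sum_weight_eq_of_vecMul_eq_zero ha_diag hr_left, ← Finset.sum_mul,
      Finset.mul_sum]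
  have expand : disagreement a r x = ∑ i, ∑ j, r i * a i j * x j ^ 2
      - ∑ i, ∑ j, r i * a i j * x i ^ 2
      + 2 * ∑ i, r i * x i * (graphLaplacian a *ᵥ x) i := by
    simp only [disagreement, graphLaplacian_mulVec ha_diag, Finset.mul_sum,
      ← Finset.sum_sub_distrib, ← Finset.sum_add_distrib]
    refine Finset.sum_congr rfl fun i _ => Finset.sum_congr rfl fun j _ => ?_
    ring
  rw [expand, key]
  ring

lemma disagreement_nonneg (ha : ∀ i j, 0 ≤ a i j) (hr : ∀ i, 0 ≤ r i) (x : Fin N → ℝ) :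
    0 ≤ disagreement a r x :=
  Finset.sum_nonneg fun i _ => Finset.sum_nonneg fun j _ =>
    mul_nonneg (mul_nonneg (hr i) (ha i j)) (sq_nonneg _)

lemma single_le_disagreement (ha : ∀ i j, 0 ≤ a i j) (hr : ∀ i, 0 ≤ r i) (x : Fin N → ℝ)
    (i j : Fin N) : r i * a i j * (x i - x j) ^ 2 ≤ disagreement a r x := by
  have hterm : ∀ i j, 0 ≤ r i * a i j * (x i - x j) ^ 2 := fun i j =>
    mul_nonneg (mul_nonneg (hr i) (ha i j)) (sq_nonneg _)
  exact (Finset.single_le_sum (fun j _ => hterm i j) (Finset.mem_univ j)).trans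
    (Finset.single_le_sum (f := fun i => ∑ j, r i * a i j * (x i - x j) ^ 2)
      (fun i _ => Finset.sum_nonneg fun j _ => hterm i j) (Finset.mem_univ i))

lemma exists_sq_sub_le_disagreement_of_transGen (ha : ∀ i j, 0 ≤ a i j) (hr : ∀ i, 0 < r i)
    {i j : Fin N} (h : Relation.TransGen (fun u v : Fin N => 0 < a v u) i j) :
    ∃ K ≥ (0 : ℝ), ∀ x : Fin N → ℝ, (x i - x j) ^ 2 ≤ K * disagreement a r x := by
  have edge : ∀ u v : Fin N, 0 < a v u →
      ∃ K ≥ (0 : ℝ), ∀ x : Fin N → ℝ, (x u - x v) ^ 2 ≤ K * disagreement a r x := by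
    intro u v huv
    have hp : 0 < r v * a v u := mul_pos (hr v) huv
    refine ⟨(r v * a v u)⁻¹, (inv_pos.2 hp).le, fun x => ?_⟩
    rw [inv_mul_eq_div, le_div_iff₀ hp]
    linarith [single_le_disagreement ha (fun i => (hr i).le) x v u]
  induction h with
  | single h => exact edge _ _ h
  | @tail b c _ hbc ih =>
    obtain ⟨K₁, hK₁, h₁⟩ := ih
    obtain ⟨K₂, hK₂, h₂⟩ := edge _ _ hbc
    refine ⟨2 * K₁ + 2 * K₂, by positivity, fun x => ?_⟩
    nlinarith [h₁ x, h₂ x, sq_nonneg ((x i - x b) - (x b - x c))]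

/-- A Poincaré inequality for strongly connected digraphs. -/
lemma exists_variance_le_disagreement (ha : ∀ i j, 0 ≤ a i j) (hsc : StronglyConnected a)
    (hr : ∀ i, 0 < r i) (hr_sum : ∑ i, r i = 1) :
    ∃ K > (0 : ℝ), ∀ x : Fin N → ℝ,
      ∑ i, r i * (x i - ∑ k, r k * x k) ^ 2 ≤ K * disagreement a r x := by
  have hpair : ∀ i j : Fin N, ∃ K ≥ (0 : ℝ), ∀ x : Fin N → ℝ,
      (x i - x j) ^ 2 ≤ K * disagreement a r x := by
    intro i j
    by_cases h : i = j
    · exact ⟨0, le_rfl, fun x => by simp [h]⟩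
    · exact exists_sq_sub_le_disagreement_of_transGen ha hr (hsc i j h)
  choose K hK hKx using hpair
  have hS : 0 ≤ ∑ i, ∑ j, r i * r j * K i j :=
    Finset.sum_nonneg fun i _ => Finset.sum_nonneg fun j _ =>
      mul_nonneg (mul_nonneg (hr i).le (hr j).le) (hK i j)
  refine ⟨∑ i, ∑ j, r i * r j * K i j + 1, by positivity, fun x => ?_⟩
  have hD := disagreement_nonneg ha (fun i => (hr i).le) x
  set m := ∑ k, r k * x k with hm
  have jensen : ∀ i, (x i - m) ^ 2 ≤ ∑ j, r j * (x i - x j) ^ 2 := by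
    intro i
    have hexp : ∑ j, r j * (x i - x j) ^ 2 = (x i - m) ^ 2 + ∑ j, r j * (x j - m) ^ 2 := by
      have : ∀ j, r j * (x i - x j) ^ 2 = r j * (x i - m) ^ 2 + r j * (x j - m) ^ 2
          - 2 * (x i - m) * (r j * x j) + 2 * (x i - m) * m * r j := fun j => by ring
      simp only [this, Finset.sum_add_distrib, Finset.sum_sub_distrib, ← Finset.mul_sum,
        ← Finset.sum_mul, hr_sum, ← hm]
      ring
    rw [hexp]
    exact le_add_of_nonneg_right
      (Finset.sum_nonneg fun j _ => mul_nonneg (hr j).le (sq_nonneg _))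
  calc ∑ i, r i * (x i - m) ^ 2
      ≤ ∑ i, ∑ j, r i * r j * K i j * disagreement a r x := by
        refine Finset.sum_le_sum fun i _ => ?_
        refine (mul_le_mul_of_nonneg_left (jensen i) (hr i).le).trans ?_
        rw [Finset.mul_sum]
        refine Finset.sum_le_sum fun j _ => ?_
        calc r i * (r j * (x i - x j) ^ 2) = r i * r j * (x i - x j) ^ 2 := by ring
          _ ≤ r i * r j * (K i j * disagreement a r x) :=
            mul_le_mul_of_nonneg_left (hKx i j x) (mul_pos (hr i) (hr j)).le
          _ = _ := by ring
    _ = (∑ i, ∑ j, r i * r j * K i j) * disagreement a r x := by simp only [Finset.sum_mul]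
    _ ≤ _ := by nlinarith

lemma hasDerivAt_min_zero_sq (x : ℝ) :
    HasDerivAt (fun y : ℝ => (min y 0) ^ 2) (2 * min x 0) x := by
  rcases lt_trichotomy x 0 with h | rfl | h
  · have := (hasDerivAt_pow 2 x).congr_of_eventuallyEq
      (f₁ := fun y : ℝ => (min y 0) ^ 2) (by
        filter_upwards [Iio_mem_nhds h] with y hy
        rw [min_eq_left (le_of_lt hy)])
    simpa [min_eq_left h.le] using this
  · rw [hasDerivAt_iff_isLittleO_nhds_zero]
    have h2 : (fun h : ℝ => h ^ 2) =o[nhds 0] fun h : ℝ => h := by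
      simpa using Asymptotics.isLittleO_pow_id (𝕜 := ℝ) one_lt_two
    refine Asymptotics.IsBigO.trans_isLittleO (Asymptotics.IsBigO.of_bound 1 ?_) h2
    filter_upwards with h
    rcases le_total h 0 with hh | hh <;> simp [hh]
  · have := (hasDerivAt_const x (0 : ℝ)).congr_of_eventuallyEq
      (f₁ := fun y : ℝ => (min y 0) ^ 2) (by
        filter_upwards [Ioi_mem_nhds h] with y hy
        rw [min_eq_right (le_of_lt hy)]; norm_num)
    simpa [min_eq_right h.le] using this

variable {x : ℝ → Fin N → ℝ}

lemma laplacian_flow_nonneg (ha : ∀ i j, 0 ≤ a i j) (ha_diag : ∀ i, a i i = 0)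
    (hr : ∀ i, 0 < r i) (hr_left : Matrix.vecMul r (graphLaplacian a) = 0)
    (hx : ∀ t i, HasDerivAt (fun τ => x τ i) (-(graphLaplacian a *ᵥ x t) i) t)
    (hx0 : ∀ i, 0 ≤ x 0 i) {t : ℝ} (ht : 0 ≤ t) (i : Fin N) : 0 ≤ x t i := by
  have hderiv : ∀ t, HasDerivAt (fun τ => ∑ i, r i * (min (x τ i) 0) ^ 2)
      (∑ i, r i * (2 * min (x t i) 0 * -(graphLaplacian a *ᵥ x t) i)) t := fun t =>
    HasDerivAt.fun_sum fun i _ =>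
      HasDerivAt.const_mul (r i)
        (HasDerivAt.comp (h := fun τ => x τ i) t (hasDerivAt_min_zero_sq (x t i)) (hx t i))
  have hanti := antitone_of_hasDerivAt_nonpos hderiv fun t => by
    rw [Pi.zero_apply]
    have hle : ∑ i, r i * (2 * min (x t i) 0 * -(graphLaplacian a *ᵥ x t) i)
        ≤ -disagreement a r (fun i => min (x t i) 0) := by
      rw [disagreement_eq ha_diag hr_left, Finset.mul_sum, ← Finset.sum_neg_distrib]
      refine Finset.sum_le_sum fun i _ => ?_
      simp only [graphLaplacian_mulVec ha_diag]
      have : min (x t i) 0 * ∑ k, a i k * (min (x t i) 0 - min (x t k) 0)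
          ≤ min (x t i) 0 * ∑ k, a i k * (x t i - x t k) := by
        rw [Finset.mul_sum, Finset.mul_sum]
        refine Finset.sum_le_sum fun k _ => ?_
        have : min (x t i) 0 * (min (x t i) 0 - min (x t k) 0)
            ≤ min (x t i) 0 * (x t i - x t k) := by
          rcases le_total (x t i) 0 with h | h
          · rw [min_eq_left h]
            nlinarith [min_le_left (x t k) 0]
          · simp [min_eq_right h]
        nlinarith [mul_le_mul_of_nonneg_left this (ha i k)]
      nlinarith [mul_le_mul_of_nonneg_left this (hr i).le]
    linarith [disagreement_nonneg ha (fun i => (hr i).le) fun i => min (x t i) 0]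
  have h0 : ∑ i, r i * (min (x t i) 0) ^ 2 ≤ 0 := by
    simpa [min_eq_right (hx0 _)] using hanti ht
  have hi : r i * (min (x t i) 0) ^ 2 ≤ 0 :=
    (Finset.single_le_sum (f := fun i => r i * (min (x t i) 0) ^ 2)
      (fun i _ => mul_nonneg (hr i).le (sq_nonneg _)) (Finset.mem_univ i)).trans h0
  have hmin : min (x t i) 0 = 0 := by
    have : (min (x t i) 0) ^ 2 ≤ 0 := nonpos_of_mul_nonpos_right hi (hr i)
    exact pow_eq_zero_iff two_ne_zero |>.1 (le_antisymm this (sq_nonneg _))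
  exact min_eq_right_iff.1 hmin

lemma laplacian_flow_pos (ha : ∀ i j, 0 ≤ a i j) (ha_diag : ∀ i, a i i = 0)
    (hr : ∀ i, 0 < r i) (hr_left : Matrix.vecMul r (graphLaplacian a) = 0)
    (hx : ∀ t i, HasDerivAt (fun τ => x τ i) (-(graphLaplacian a *ᵥ x t) i) t)
    (hx0 : ∀ i, 0 ≤ x 0 i) {t : ℝ} (ht : 0 ≤ t) {i : Fin N} (hi : 0 < x 0 i) :
    0 < x t i := by
  set d := ∑ k, a i k with hd
  have hderiv : ∀ t, HasDerivAt (fun τ => Real.exp (d * τ) * x τ i)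
      (Real.exp (d * t) * ∑ k, a i k * x t k) t := by
    intro t
    have he : HasDerivAt (fun τ => Real.exp (d * τ)) (Real.exp (d * t) * d) t := by
      simpa using ((hasDerivAt_id t).const_mul d).exp
    refine (he.mul (hx t i)).congr_deriv ?_
    simp only [graphLaplacian_mulVec ha_diag, mul_sub, Finset.sum_sub_distrib,
      ← Finset.sum_mul, ← hd]
    ring
  have hmono : MonotoneOn (fun τ => Real.exp (d * τ) * x τ i) (Set.Ici 0) := by
    refine monotoneOn_of_deriv_nonneg (convex_Ici 0)
      (fun t _ => (hderiv t).continuousAt.continuousWithinAt)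
      (fun t _ => (hderiv t).differentiableAt.differentiableWithinAt) fun t ht => ?_
    rw [interior_Ici] at ht
    rw [(hderiv t).deriv]
    exact mul_nonneg (Real.exp_pos _).le (Finset.sum_nonneg fun k _ => mul_nonneg (ha i k)
      (laplacian_flow_nonneg ha ha_diag hr hr_left hx hx0 (le_of_lt ht) k))
  have h := hmono Set.self_mem_Ici ht ht
  simp only [mul_zero, Real.exp_zero, one_mul] at h
  exact pos_of_mul_pos_right (hi.trans_le h) (Real.exp_pos _).le

lemma laplacian_flow_mean_eq (hr_left : Matrix.vecMul r (graphLaplacian a) = 0)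
    (hx : ∀ t i, HasDerivAt (fun τ => x τ i) (-(graphLaplacian a *ᵥ x t) i) t) (t : ℝ) :
    ∑ i, r i * x t i = ∑ i, r i * x 0 i := by
  have hderiv : ∀ t, HasDerivAt (fun τ => ∑ i, r i * x τ i) 0 t := fun t => by
    refine (HasDerivAt.fun_sum fun i _ => (hx t i).const_mul (r i)).congr_deriv ?_
    have h : r ⬝ᵥ (graphLaplacian a *ᵥ x t) = 0 := by
      rw [Matrix.dotProduct_mulVec, hr_left, zero_dotProduct]
    simpa [dotProduct] using h
  exact is_const_of_deriv_eq_zero (fun t => (hderiv t).differentiableAt)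
    (fun t => (hderiv t).deriv) t 0

lemma laplacian_flow_variance_le (ha_diag : ∀ i, a i i = 0)
    (hr_left : Matrix.vecMul r (graphLaplacian a) = 0)
    {K : ℝ} (hK : 0 < K) (hpoincare : ∀ x : Fin N → ℝ,
      ∑ i, r i * (x i - ∑ k, r k * x k) ^ 2 ≤ K * disagreement a r x)
    (hx : ∀ t i, HasDerivAt (fun τ => x τ i) (-(graphLaplacian a *ᵥ x t) i) t)
    {t : ℝ} (ht : 0 ≤ t) :
    ∑ i, r i * (x t i - ∑ k, r k * x 0 k) ^ 2 ≤
      (∑ i, r i * (x 0 i - ∑ k, r k * x 0 k) ^ 2) * Real.exp (-K⁻¹ * t) := by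
  set m := ∑ k, r k * x 0 k with hm
  have hderiv : ∀ t, HasDerivAt
      (fun τ => Real.exp (K⁻¹ * τ) * ∑ i, r i * (x τ i - m) ^ 2)
      (Real.exp (K⁻¹ * t) * (K⁻¹ * ∑ i, r i * (x t i - m) ^ 2 - disagreement a r (x t))) t := by
    intro t
    have he : HasDerivAt (fun τ => Real.exp (K⁻¹ * τ)) (Real.exp (K⁻¹ * t) * K⁻¹) t := by
      simpa using ((hasDerivAt_id t).const_mul K⁻¹).exp
    have hV : HasDerivAt (fun τ => ∑ i, r i * (x τ i - m) ^ 2)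
        (-disagreement a r (x t)) t := by
      refine (HasDerivAt.fun_sum fun i _ =>
        (((hx t i).sub_const m).pow 2).const_mul (r i)).congr_deriv ?_
      have h : ∑ i, r i * (graphLaplacian a *ᵥ x t) i = 0 := by
        change r ⬝ᵥ (graphLaplacian a *ᵥ x t) = 0
        rw [Matrix.dotProduct_mulVec, hr_left, zero_dotProduct]
      have h' : ∀ i, r i * (((2 : ℕ) : ℝ) * (x t i - m) ^ (2 - 1) *
            -(graphLaplacian a *ᵥ x t) i) =
          -(2 * (r i * x t i * (graphLaplacian a *ᵥ x t) i))
            + 2 * m * (r i * (graphLaplacian a *ᵥ x t) i) := fun i => by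
        norm_num; ring
      rw [disagreement_eq ha_diag hr_left, Finset.sum_congr rfl fun i _ => h' i,
        Finset.sum_add_distrib, ← Finset.mul_sum, h, Finset.sum_neg_distrib, ← Finset.mul_sum]
      ring
    exact (he.mul hV).congr_deriv (by ring)
  have hanti := antitone_of_hasDerivAt_nonpos hderiv fun t => by
    refine mul_nonpos_of_nonneg_of_nonpos (Real.exp_pos _).le ?_
    have hp := hpoincare (x t)
    rw [laplacian_flow_mean_eq hr_left hx t, ← hm, ← inv_mul_le_iff₀ hK] at hp
    linarith
  have h := hanti ht
  simp only [mul_zero, Real.exp_zero, one_mul] at h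
  rw [neg_mul, Real.exp_neg, ← div_eq_mul_inv, le_div_iff₀ (Real.exp_pos _)]
  linarith

end Laplacian

/-- The diagonal entries of the solution of `Ẇ = −L W`, `W(0) = I`, stay
strictly positive and converge exponentially to the entries of the normalized
positive left eigenvector `r` of the Laplacian `L`.  (The matrix equation is
stated entrywise: each entry of `W` has the prescribed derivative.) -/
theorem eigenvector_estimator_diagonal_positive_and_exponential
    (N : ℕ) (hN : 2 ≤ N) (a : Fin N → Fin N → ℝ)
    (ha_nonneg : ∀ i j, 0 ≤ a i j) (ha_diag : ∀ i, a i i = 0)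
    (hsc : StronglyConnected a)
    (r : Fin N → ℝ) (hr_pos : ∀ i, 0 < r i)
    (hr_left : Matrix.vecMul r (graphLaplacian a) = 0)
    (hr_sum : ∑ i, r i = 1)
    (W : ℝ → Matrix (Fin N) (Fin N) ℝ)
    (hW0 : W 0 = 1)
    (hWdyn : ∀ (t : ℝ) (i j : Fin N),
      HasDerivAt (fun τ => W τ i j) ((-(graphLaplacian a) * W t) i j) t) :
    (∀ i : Fin N, ∀ t : ℝ, 0 ≤ t → 0 < W t i i) ∧
    ∃ c > (0 : ℝ), ∃ lam > (0 : ℝ),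
      ∀ i : Fin N, ∀ t : ℝ, 0 ≤ t →
        |W t i i - r i| ≤ c * Real.exp (-lam * t) := by
  have hflow : ∀ j t i, HasDerivAt (fun τ => W τ i j)
      (-(graphLaplacian a *ᵥ fun k => W t k j) i) t := fun j t i => by
    refine (hWdyn t i j).congr_deriv ?_
    simp [Matrix.mul_apply, Matrix.mulVec, dotProduct]
  refine ⟨fun i t ht => ?_, ?_⟩
  · refine laplacian_flow_pos (x := fun τ k => W τ k i) ha_nonneg ha_diag hr_pos hr_left
      (hflow i) (fun k => ?_) ht ?_
    · by_cases h : k = i <;> simp [hW0, h]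
    · simp [hW0]
  obtain ⟨K, hK, hpoincare⟩ := exists_variance_le_disagreement ha_nonneg hsc hr_pos hr_sum
  set V : Fin N → ℝ := fun j => ∑ i, r i * (W 0 i j - r j) ^ 2
  have hV : ∀ j, 0 ≤ V j := fun j =>
    Finset.sum_nonneg fun i _ => mul_nonneg (hr_pos i).le (sq_nonneg _)
  have hsqrt : ∀ j, 0 ≤ √(V j / r j) := fun j => Real.sqrt_nonneg _
  refine ⟨∑ j, √(V j / r j) + 1, by positivity, K⁻¹ / 2, by positivity,
    fun i t ht => ?_⟩
  have hmean : ∑ k, r k * W 0 k i = r i := by simp [hW0, Matrix.one_apply]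
  have hvar := laplacian_flow_variance_le (x := fun τ k => W τ k i) ha_diag hr_left hK
    hpoincare (hflow i) ht
  simp only [hmean] at hvar
  have hterm : r i * (W t i i - r i) ^ 2 ≤ V i * Real.exp (-K⁻¹ * t) :=
    (Finset.single_le_sum (f := fun k => r k * (W t k i - r i) ^ 2)
      (fun k _ => mul_nonneg (hr_pos k).le (sq_nonneg _)) (Finset.mem_univ i)).trans hvar
  have hexp : Real.exp (-K⁻¹ * t) = Real.exp (-(K⁻¹ / 2) * t) ^ 2 := by
    rw [← Real.exp_nat_mul]; congr 1; push_cast; ring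
  have hsq : (W t i i - r i) ^ 2 ≤ (√(V i / r i) * Real.exp (-(K⁻¹ / 2) * t)) ^ 2 := by
    rw [mul_pow, Real.sq_sqrt (div_nonneg (hV i) (hr_pos i).le), ← hexp, div_mul_eq_mul_div,
      le_div_iff₀ (hr_pos i)]
    linarith
  refine (abs_le_of_sq_le_sq hsq (by positivity)).trans ?_
  refine mul_le_mul_of_nonneg_right ?_ (Real.exp_pos _).le
  linarith [Finset.single_le_sum (f := fun j => √(V j / r j)) (fun j _ => hsqrt j)
    (Finset.mem_univ i)]
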